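/- If T is a π-ad invariant k-subspace of A₁ and R is the right ideal of A₁ generated by T, then R is π-ad invariant, i.e. ad_α(R) ⊆ R ⊗ A_α for all α ∈ π. (In particular, for all a, b ∈ A₁ and α ∈ π one has ad_α(ab) = (1₁ ⊗ S_{α⁻¹}(b_(1,α⁻¹)))·ad_α(a)·Δ_{1,α}(b_(2,α)), where Δ_{α⁻¹,α}(b) = Σ b_(1,α⁻¹) ⊗ b_(2,α).) -/

import Mathlib

open TensorProduct

/-- The adjoint coaction `ad_α : A₁ → A₁ ⊗ A_α`,
`ad_α(a) = Σ a_(2,1) ⊗ S_{α⁻¹}(a_(1,α⁻¹))·a_(3,α)`. -/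
noncomputable def adMap {k : Type} [Field k] {G : Type} [Group G]
    (A : G → Type) [∀ α, Ring (A α)] [∀ α, Algebra k (A α)]
    (Δ : ∀ α β γ : G, α * β = γ → (A γ →ₐ[k] A α ⊗[k] A β))
    (S : ∀ α β : G, α⁻¹ = β → (A α →ₗ[k] A β))
    (α : G) : A 1 →ₗ[k] A 1 ⊗[k] A α :=
  (LinearMap.lTensor (A 1)
      ((LinearMap.mul' k (A α)) ∘ₗ
        (TensorProduct.map (S α⁻¹ α (inv_inv α)) LinearMap.id))) ∘ₗ
    (TensorProduct.leftComm k (A α⁻¹) (A 1) (A α)).toLinearMap ∘ₗ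
    (LinearMap.lTensor (A α⁻¹) (Δ 1 α α (one_mul α)).toLinearMap) ∘ₗ
    (Δ α⁻¹ α 1 (inv_mul_cancel α)).toLinearMap

section AdjointCoaction

variable {k H B C : Type*} [CommRing k] [Ring H] [Ring B] [Ring C]
  [Algebra k H] [Algebra k B] [Algebra k C]

/-- The pairing `(p ⊗ q ⊗ r) ⊗ (p' ⊗ q' ⊗ r') ↦ s(pp') qq' s(r') s(r)`. -/
noncomputable def antipodePairing (s : B →ₗ[k] C) :
    (B ⊗[k] (C ⊗[k] B)) ⊗[k] (B ⊗[k] (C ⊗[k] B)) →ₗ[k] C :=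
  LinearMap.mul' k C ∘ₗ
    TensorProduct.map (s ∘ₗ LinearMap.mul' k B)
      (LinearMap.mul' k C ∘ₗ
        TensorProduct.map (LinearMap.mul' k C)
          (LinearMap.mul' k C ∘ₗ TensorProduct.map s s ∘ₗ
            (TensorProduct.comm k B B).toLinearMap) ∘ₗ
        (TensorProduct.tensorTensorTensorComm k C B C B).toLinearMap) ∘ₗ
    (TensorProduct.tensorTensorTensorComm k B (C ⊗[k] B) B (C ⊗[k] B)).toLinearMap

lemma antipodePairing_tmul (s : B →ₗ[k] C) (p p' r r' : B) (q q' : C) :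
    antipodePairing s ((p ⊗ₜ (q ⊗ₜ r)) ⊗ₜ (p' ⊗ₜ (q' ⊗ₜ r')))
      = s (p * p') * ((q * q') * (s r' * s r)) := by
  simp [antipodePairing]

lemma antipodePairing_tmul_tmul (s : B →ₗ[k] C) (p p' : B) (v v' : C ⊗[k] B) (e e' : k)
    (hv : LinearMap.mul' k C (LinearMap.lTensor C s v) = e • 1)
    (hv' : LinearMap.mul' k C (LinearMap.lTensor C s v') = e' • 1) :
    antipodePairing s ((p ⊗ₜ v) ⊗ₜ (p' ⊗ₜ v')) = (e * e') • s (p * p') := by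
  have inner (q : C) (r : B) : antipodePairing s ((p ⊗ₜ (q ⊗ₜ r)) ⊗ₜ (p' ⊗ₜ v'))
      = s (p * p') * (q * (LinearMap.mul' k C (LinearMap.lTensor C s v') * s r)) := by
    clear hv'
    induction v' with
    | zero => simp
    | add x y hx hy => simp only [tmul_add, map_add, hx, hy, add_mul, mul_add]
    | tmul q' r' => simp [antipodePairing_tmul, mul_assoc]
  have outer : antipodePairing s ((p ⊗ₜ v) ⊗ₜ (p' ⊗ₜ v'))
      = e' • (s (p * p') * LinearMap.mul' k C (LinearMap.lTensor C s v)) := by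
    clear hv
    induction v with
    | zero => simp
    | add x y hx hy => simp only [tmul_add, add_tmul, map_add, hx, hy, mul_add, smul_add]
    | tmul q r => simp [inner, hv']
  rw [outer, hv, mul_smul_comm, mul_one, smul_smul, mul_comm]

lemma antipodePairing_assoc_tmul (s : B →ₗ[k] C) (r r' : B) (v v' : B ⊗[k] C) :
    antipodePairing s (TensorProduct.assoc k B C B (v ⊗ₜ r) ⊗ₜ
        TensorProduct.assoc k B C B (v' ⊗ₜ r'))
      = LinearMap.mul' k C (LinearMap.rTensor C s (v * v')) * (s r' * s r) := by
  induction v with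
  | zero => simp
  | add x y hx hy => simp only [add_tmul, map_add, hx, hy, add_mul]
  | tmul p q =>
    induction v' with
    | zero => simp
    | add x y hx hy => simp only [add_tmul, tmul_add, map_add, hx, hy, add_mul, mul_add]
    | tmul p' q' => simp [antipodePairing_tmul, mul_assoc]

/-- A component of the antipode reverses products. -/
theorem antipode_mul (s : B →ₗ[k] C) (ε : H →ₐ[k] k)
    (ΔBH : B →ₐ[k] B ⊗[k] H) (ΔHB : B →ₐ[k] H ⊗[k] B)
    (ΔBC : H →ₐ[k] B ⊗[k] C) (ΔCB : H →ₐ[k] C ⊗[k] B)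
    (hcoassoc : ∀ x, TensorProduct.assoc k B C B
        (Algebra.TensorProduct.map ΔBC (AlgHom.id k B) (ΔHB x))
      = Algebra.TensorProduct.map (AlgHom.id k B) ΔCB (ΔBH x))
    (hrid : ∀ x, TensorProduct.rid k B (LinearMap.lTensor B ε.toLinearMap (ΔBH x)) = x)
    (hlid : ∀ x, TensorProduct.lid k B (LinearMap.rTensor B ε.toLinearMap (ΔHB x)) = x)
    (hleft : ∀ x, LinearMap.mul' k C (LinearMap.rTensor C s (ΔBC x)) = ε x • 1)
    (hright : ∀ x, LinearMap.mul' k C (LinearMap.lTensor C s (ΔCB x)) = ε x • 1)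
    (x y : B) : s (x * y) = s y * s x := by
  have eval_right (w w' : B ⊗[k] H) :
      antipodePairing s (Algebra.TensorProduct.map (AlgHom.id k B) ΔCB w ⊗ₜ
          Algebra.TensorProduct.map (AlgHom.id k B) ΔCB w')
        = s (TensorProduct.rid k B (LinearMap.lTensor B ε.toLinearMap w) *
            TensorProduct.rid k B (LinearMap.lTensor B ε.toLinearMap w')) := by
    induction w with
    | zero => simp
    | add a b ha hb => simp only [add_tmul, map_add, ha, hb, add_mul]
    | tmul p h =>
      induction w' with
      | zero => simp
      | add a b ha hb => simp only [tmul_add, map_add, ha, hb, mul_add]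
      | tmul p' h' =>
        simp [antipodePairing_tmul_tmul s p p' _ _ _ _ (hright h) (hright h'), smul_smul,
          mul_comm]
  have eval_left (w w' : H ⊗[k] B) :
      antipodePairing s (TensorProduct.assoc k B C B
            (Algebra.TensorProduct.map ΔBC (AlgHom.id k B) w) ⊗ₜ
          TensorProduct.assoc k B C B (Algebra.TensorProduct.map ΔBC (AlgHom.id k B) w'))
        = s (TensorProduct.lid k B (LinearMap.rTensor B ε.toLinearMap w')) *
            s (TensorProduct.lid k B (LinearMap.rTensor B ε.toLinearMap w)) := by
    induction w with
    | zero => simp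
    | add a b ha hb => simp only [add_tmul, map_add, ha, hb, mul_add]
    | tmul h r =>
      induction w' with
      | zero => simp
      | add a b ha hb => simp only [tmul_add, map_add, ha, hb, add_mul]
      | tmul h' r' =>
        simp only [Algebra.TensorProduct.map_tmul, AlgHom.coe_id, id_eq,
          antipodePairing_assoc_tmul, ← map_mul ΔBC, hleft]
        simp [smul_smul]
  have h := eval_right (ΔBH x) (ΔBH y)
  rw [← hcoassoc, ← hcoassoc, eval_left, hrid, hrid, hlid, hlid] at h
  exact h.symm

/-- The map `b ⊗ h ⊗ c ↦ h ⊗ s(b) c` through which the adjoint coaction factors. -/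
noncomputable def adContraction (s : B →ₗ[k] C) :
    B ⊗[k] (H ⊗[k] C) →ₗ[k] H ⊗[k] C :=
  LinearMap.lTensor H (LinearMap.mul' k C ∘ₗ TensorProduct.map s LinearMap.id) ∘ₗ
    (TensorProduct.leftComm k B H C).toLinearMap

lemma adContraction_mul_tmul (s : B →ₗ[k] C) (hs : ∀ x y, s (x * y) = s y * s x)
    (t : B ⊗[k] (H ⊗[k] C)) (b : B) (z : H ⊗[k] C) :
    adContraction s (t * (b ⊗ₜ z)) = (1 ⊗ₜ s b) * adContraction s t * z := by
  induction t with
  | zero => simp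
  | add t u ht hu => simp only [add_mul, map_add, ht, hu, mul_add]
  | tmul p v =>
    induction v with
    | zero => simp
    | add v w hv hw => simp only [tmul_add, add_mul, map_add, hv, hw, mul_add]
    | tmul h c =>
      induction z with
      | zero => simp
      | add v w hv hw => simp only [tmul_add, map_add, hv, hw, mul_add]
      | tmul h' c' => simp [adContraction, hs, mul_assoc]

lemma rTensor_subtype_range_mul_mem (T R : Submodule k H)
    (hTR : ∀ x ∈ T, ∀ c, x * c ∈ R) (u : H ⊗[k] C)
    (hu : u ∈ LinearMap.range (LinearMap.rTensor C T.subtype)) (c : C) (z : H ⊗[k] C) :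
    (1 ⊗ₜ c) * u * z ∈ LinearMap.range (LinearMap.rTensor C R.subtype) := by
  obtain ⟨t, rfl⟩ := hu
  induction t with
  | zero => simp
  | add t u ht hu =>
    simp only [map_add, mul_add, add_mul]
    exact add_mem ht hu
  | tmul x d =>
    induction z with
    | zero => simp
    | add v w hv hw =>
      simp only [mul_add]
      exact add_mem hv hw
    | tmul h e => exact ⟨⟨x * h, hTR x x.2 h⟩ ⊗ₜ (c * d * e), by simp⟩

end AdjointCoaction

/-- If `T` is a `π`-ad invariant subspace of `A₁` and `R` is the right
ideal of `A₁` generated by `T`, then `R` is `π`-ad invariant; in particular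
`ad_α(ab) = (1₁ ⊗ S_{α⁻¹}(b₍₁₎))·ad_α(a)·Δ_{1,α}(b₍₂₎)` for all `a, b ∈ A₁`. -/
theorem right_ideal_generated_by_ad_invariant_is_ad_invariant
    {k : Type} [Field k] {G : Type} [Group G]
    (A : G → Type) [∀ α, Ring (A α)] [∀ α, Algebra k (A α)]
    (Δ : ∀ α β γ : G, α * β = γ → (A γ →ₐ[k] A α ⊗[k] A β))
    (ε : A 1 →ₐ[k] k)
    (S : ∀ α β : G, α⁻¹ = β → (A α →ₗ[k] A β))
    (hcoassoc : ∀ (α β γ : G) (x : A (α * β * γ)),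
      (TensorProduct.assoc k (A α) (A β) (A γ))
          ((Algebra.TensorProduct.map (Δ α β (α * β) rfl) (AlgHom.id k (A γ)))
            ((Δ (α * β) γ (α * β * γ) rfl) x))
        = (Algebra.TensorProduct.map (AlgHom.id k (A α)) (Δ β γ (β * γ) rfl))
            ((Δ α (β * γ) (α * β * γ) (mul_assoc α β γ).symm) x))
    (hcounit₁ : ∀ (α : G) (x : A α),
      (TensorProduct.rid k (A α)) ((LinearMap.lTensor (A α) ε.toLinearMap)
        ((Δ α 1 α (mul_one α)) x)) = x)
    (hcounit₂ : ∀ (α : G) (x : A α),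
      (TensorProduct.lid k (A α)) ((LinearMap.rTensor (A α) ε.toLinearMap)
        ((Δ 1 α α (one_mul α)) x)) = x)
    (hantipode₁ : ∀ (α : G) (x : A 1),
      (LinearMap.mul' k (A α)) ((LinearMap.rTensor (A α) (S α⁻¹ α (inv_inv α)))
        ((Δ α⁻¹ α 1 (inv_mul_cancel α)) x)) = ε x • 1)
    (hantipode₂ : ∀ (α : G) (x : A 1),
      (LinearMap.mul' k (A α)) ((LinearMap.lTensor (A α) (S α⁻¹ α (inv_inv α)))
        ((Δ α α⁻¹ 1 (mul_inv_cancel α)) x)) = ε x • 1)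
    (T : Submodule k (A 1))
    (hT : ∀ (α : G), ∀ x ∈ T,
      adMap A Δ S α x ∈ LinearMap.range (LinearMap.rTensor (A α) T.subtype)) :
    (∀ (α : G), ∀ y ∈ Submodule.span k {y : A 1 | ∃ x ∈ T, ∃ c : A 1, y = x * c},
      adMap A Δ S α y ∈ LinearMap.range (LinearMap.rTensor (A α)
        (Submodule.span k {y : A 1 | ∃ x ∈ T, ∃ c : A 1, y = x * c}).subtype))
    ∧ (∀ (α : G) (a b : A 1),
      adMap A Δ S α (a * b)
        = (TensorProduct.lift
            ((LinearMap.lcomp k (A 1 ⊗[k] A α) (Δ 1 α α (one_mul α)).toLinearMap) ∘ₗ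
              (LinearMap.mul k (A 1 ⊗[k] A α)) ∘ₗ
              (LinearMap.mulRight k (adMap A Δ S α a)) ∘ₗ
              (Algebra.TensorProduct.includeRight (R := k) (A := A 1) (B := A α)).toLinearMap ∘ₗ
              (S α⁻¹ α (inv_inv α))))
          ((Δ α⁻¹ α 1 (inv_mul_cancel α)) b)) := by
  have hS (α : G) (x y : A α⁻¹) :
      S α⁻¹ α (inv_inv α) (x * y)
        = S α⁻¹ α (inv_inv α) y * S α⁻¹ α (inv_inv α) x := by
    have coassoc (α β γ δ ζ η : G) (h₁ : α * β = δ) (h₂ : β * γ = ζ) (h₃ : δ * γ = η)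
        (h₄ : α * ζ = η) (x : A η) :
        TensorProduct.assoc k (A α) (A β) (A γ)
            (Algebra.TensorProduct.map (Δ α β δ h₁) (AlgHom.id k (A γ)) (Δ δ γ η h₃ x))
          = Algebra.TensorProduct.map (AlgHom.id k (A α)) (Δ β γ ζ h₂) (Δ α ζ η h₄ x) := by
      subst h₁ h₂ h₃
      exact hcoassoc α β γ x
    exact antipode_mul _ ε (Δ α⁻¹ 1 α⁻¹ (mul_one _)) (Δ 1 α⁻¹ α⁻¹ (one_mul _))
      (Δ α⁻¹ α 1 (inv_mul_cancel α)) (Δ α α⁻¹ 1 (mul_inv_cancel α))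
      (coassoc _ _ _ _ _ _ _ _ _ _) (hcounit₁ _) (hcounit₂ _)
      (hantipode₁ α) (hantipode₂ α) x y
  have ad_mul (α : G) (a b : A 1) :
      adMap A Δ S α (a * b)
        = (TensorProduct.lift
            ((LinearMap.lcomp k (A 1 ⊗[k] A α) (Δ 1 α α (one_mul α)).toLinearMap) ∘ₗ
              (LinearMap.mul k (A 1 ⊗[k] A α)) ∘ₗ
              (LinearMap.mulRight k (adMap A Δ S α a)) ∘ₗ
              (Algebra.TensorProduct.includeRight (R := k) (A := A 1) (B := A α)).toLinearMap ∘ₗ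
              (S α⁻¹ α (inv_inv α))))
          ((Δ α⁻¹ α 1 (inv_mul_cancel α)) b) := by
    have ad_eq (y : A 1) : adMap A Δ S α y = adContraction (S α⁻¹ α (inv_inv α))
        (Algebra.TensorProduct.map (AlgHom.id k (A α⁻¹)) (Δ 1 α α (one_mul α))
          (Δ α⁻¹ α 1 (inv_mul_cancel α) y)) := rfl
    rw [ad_eq (a * b), map_mul, map_mul]
    induction Δ α⁻¹ α 1 (inv_mul_cancel α) b with
    | zero => simp
    | add v w hv hw => simp only [map_add, mul_add, hv, hw]
    | tmul p h =>
      rw [Algebra.TensorProduct.map_tmul, adContraction_mul_tmul _ (hS α), ← ad_eq]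
      simp
  refine ⟨fun α y hy => ?_, ad_mul⟩
  induction hy using Submodule.span_induction with
  | zero => simp
  | add x y _ _ hx hy => rw [map_add]; exact add_mem hx hy
  | smul c x _ hx => rw [map_smul]; exact Submodule.smul_mem _ c hx
  | mem y hy =>
    obtain ⟨x, hx, c, rfl⟩ := hy
    rw [ad_mul]
    induction Δ α⁻¹ α 1 (inv_mul_cancel α) c with
    | zero => simp
    | add v w hv hw => rw [map_add]; exact add_mem hv hw
    | tmul p h =>
      refine rTensor_subtype_range_mul_mem T _ ?_ _ (hT α x hx) _ _
      exact fun x hx c => Submodule.subset_span ⟨x, hx, c, rfl⟩
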